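/- arXiv:1203.6453 — 4 statements merged into one kernel-verified Lean document; each statement's English description precedes it below -/
import Mathlib

section
/- Let n and m be natural numbers and let H_1, …, H_m be affine hyperplanes in ℝ^n. Then the set of regions of the family (i.e., the connected components of ℝ^n \ (H_1 ∪ … ∪ H_m)) is finite, and its cardinality is at most ∑_{i=0}^{n} binomial(m, i). -/
open Classical in
/-- The indices of the affine functions `f k - c k` that are positive at `x`. -/
noncomputable def positiveIndices {ι V : Type*} [Fintype ι] [AddCommGroup V] [Module ℝ V]
    (f : ι → V →ₗ[ℝ] ℝ) (c : ι → ℝ) (x : V) : Finset ι :=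
  Finset.univ.filter fun k => c k < f k x

theorem mem_positiveIndices {ι V : Type*} [Fintype ι] [AddCommGroup V] [Module ℝ V]
    {f : ι → V →ₗ[ℝ] ℝ} {c : ι → ℝ} {x : V} {k : ι} :
    k ∈ positiveIndices f c x ↔ c k < f k x := by
  simp [positiveIndices]

open Classical in
/-- The sets `positiveIndices f c x`, for `x` outside all the hyperplanes `f k = c k`. -/
noncomputable def signFamily {ι V : Type*} [Fintype ι] [AddCommGroup V] [Module ℝ V]
    (f : ι → V →ₗ[ℝ] ℝ) (c : ι → ℝ) : Finset (Finset ι) :=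
  Finset.univ.filter fun A => ∃ x, (∀ k, f k x ≠ c k) ∧ positiveIndices f c x = A

theorem mem_signFamily {ι V : Type*} [Fintype ι] [AddCommGroup V] [Module ℝ V]
    {f : ι → V →ₗ[ℝ] ℝ} {c : ι → ℝ} {A : Finset ι} :
    A ∈ signFamily f c ↔ ∃ x, (∀ k, f k x ≠ c k) ∧ positiveIndices f c x = A := by
  simp [signFamily]

/-- If `signFamily f c` shatters `s`, one can prescribe which functions are positive on `s`. -/
theorem exists_point_of_shatters {ι V : Type*} [Fintype ι] [DecidableEq ι] [AddCommGroup V]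
    [Module ℝ V] {f : ι → V →ₗ[ℝ] ℝ} {c : ι → ℝ} {s : Finset ι}
    (hs : (signFamily f c).Shatters s) (p : ι → Prop) :
    ∃ x, ∀ k ∈ s, f k x ≠ c k ∧ (c k < f k x ↔ p k) := by
  classical
  obtain ⟨u, hu, hsu⟩ := hs (Finset.filter_subset p s)
  obtain ⟨x, hx, rfl⟩ := mem_signFamily.1 hu
  refine ⟨x, fun k hk => ⟨hx k, ?_⟩⟩
  have := Finset.ext_iff.1 hsu k
  simpa [hk, mem_positiveIndices] using this

/-- Functionals indexed by a shattered set satisfy no nontrivial linear relation. -/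
theorem linearIndependent_of_shatters {ι V : Type*} [Fintype ι] [DecidableEq ι] [AddCommGroup V]
    [Module ℝ V] {f : ι → V →ₗ[ℝ] ℝ} {c : ι → ℝ} {s : Finset ι}
    (hs : (signFamily f c).Shatters s) :
    LinearIndependent ℝ fun k : s => f k := by
  rw [Fintype.linearIndependent_iff]
  intro a ha
  by_contra! hne
  obtain ⟨i, hi⟩ := hne
  have key : ∀ x, ∑ k : s, a k * (f k x - c k) = -∑ k : s, a k * c k := by
    intro x
    have h := LinearMap.congr_fun ha x
    simp only [LinearMap.sum_apply, LinearMap.smul_apply, smul_eq_mul,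
      LinearMap.zero_apply] at h
    simp only [mul_sub, Finset.sum_sub_distrib, h, zero_sub]
  obtain ⟨x, hx⟩ := exists_point_of_shatters hs fun k => ∃ h : k ∈ s, 0 < a ⟨k, h⟩
  obtain ⟨y, hy⟩ := exists_point_of_shatters hs fun k => ∃ h : k ∈ s, a ⟨k, h⟩ < 0
  have hpos : ∀ k : s, a k ≠ 0 → 0 < a k * (f k x - c k) := by
    intro k hk
    obtain ⟨hne, hiff⟩ := hx k k.2
    simp only [Subtype.coe_eta, Finset.coe_mem, exists_true_left] at hiff
    rcases lt_or_gt_of_ne hk with h | h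
    · have : f k x < c k := lt_of_le_of_ne (not_lt.1 fun h' => h.not_gt (hiff.1 h')) hne
      exact mul_pos_of_neg_of_neg h (sub_neg.2 this)
    · exact mul_pos h (sub_pos.2 (hiff.2 h))
  have hneg : ∀ k : s, a k ≠ 0 → a k * (f k y - c k) < 0 := by
    intro k hk
    obtain ⟨hne, hiff⟩ := hy k k.2
    simp only [Subtype.coe_eta, Finset.coe_mem, exists_true_left] at hiff
    rcases lt_or_gt_of_ne hk with h | h
    · exact mul_neg_of_neg_of_pos h (sub_pos.2 (hiff.2 h))
    · have : f k y < c k := lt_of_le_of_ne (not_lt.1 fun h' => h.not_gt (hiff.1 h')) hne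
      exact mul_neg_of_pos_of_neg h (sub_neg.2 this)
  have h1 : 0 < ∑ k : s, a k * (f k x - c k) :=
    Finset.sum_pos' (fun k _ => by
      by_cases hk : a k = 0
      · simp [hk]
      · exact (hpos k hk).le) ⟨i, Finset.mem_univ _, hpos i hi⟩
  have h2 : ∑ k : s, a k * (f k y - c k) < 0 :=
    Finset.sum_neg' (fun k _ => by
      by_cases hk : a k = 0
      · simp [hk]
      · exact (hneg k hk).le) ⟨i, Finset.mem_univ _, hneg i hi⟩
  rw [key] at h1 h2
  exact lt_asymm h1 h2

theorem vcDim_signFamily_le {ι V : Type*} [Fintype ι] [DecidableEq ι] [AddCommGroup V]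
    [Module ℝ V] [FiniteDimensional ℝ V] (f : ι → V →ₗ[ℝ] ℝ) (c : ι → ℝ) :
    (signFamily f c).vcDim ≤ Module.finrank ℝ V := by
  refine Finset.sup_le fun s hs => ?_
  have h := (linearIndependent_of_shatters (Finset.mem_shatterer.1 hs)).fintype_card_le_finrank
  rwa [Fintype.card_coe, Subspace.dual_finrank_eq] at h

theorem card_signFamily_le {ι V : Type*} [Fintype ι] [AddCommGroup V]
    [Module ℝ V] [FiniteDimensional ℝ V] (f : ι → V →ₗ[ℝ] ℝ) (c : ι → ℝ) :
    (signFamily f c).card ≤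
      ∑ i ∈ Finset.range (Module.finrank ℝ V + 1), (Fintype.card ι).choose i := by
  classical
  refine (Finset.card_le_card_shatterer _).trans (Finset.card_shatterer_le_sum_vcDim.trans ?_)
  refine Finset.sum_le_sum_of_subset fun i hi => ?_
  have := vcDim_signFamily_le f c
  simp only [Finset.mem_Iic, Finset.mem_range] at hi ⊢
  omega

/-- Points outside the hyperplanes with the same positive indices are joined by a segment
that avoids the hyperplanes. -/
theorem segment_subset_of_positiveIndices_eq {ι V : Type*} [Fintype ι] [AddCommGroup V]
    [Module ℝ V] {f : ι → V →ₗ[ℝ] ℝ} {c : ι → ℝ} {x y : V} (hx : ∀ k, f k x ≠ c k)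
    (hy : ∀ k, f k y ≠ c k) (h : positiveIndices f c x = positiveIndices f c y) :
    segment ℝ x y ⊆ {z | ∀ k, f k z ≠ c k} := by
  intro z hz k
  have hk := Finset.ext_iff.1 h k
  rw [mem_positiveIndices, mem_positiveIndices] at hk
  rcases lt_or_gt_of_ne (hx k) with hxk | hxk
  · have hyk : f k y < c k :=
      lt_of_le_of_ne (not_lt.1 fun h' => hxk.not_gt (hk.2 h')) (hy k)
    exact ((convex_halfSpace_lt (f k).isLinear (c k)).segment_subset hxk hyk hz).ne
  · exact ((convex_halfSpace_gt (f k).isLinear (c k)).segment_subset hxk (hk.1 hxk) hz).ne.symm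


/-- An affine hyperplane in `ℝ^n` (modeled as `Fin n → ℝ`): a set of the form
`{x | f x = c}` for some nonzero linear functional `f` and real `c`. -/
def IsAffineHyperplane {n : ℕ} (H : Set (Fin n → ℝ)) : Prop :=
  ∃ (f : (Fin n → ℝ) →ₗ[ℝ] ℝ) (c : ℝ), f ≠ 0 ∧ H = {x | f x = c}

/-- The set of regions of a family of hyperplanes: the connected components of
the complement of their union. -/
def regions {n m : ℕ} (H : Fin m → Set (Fin n → ℝ)) : Set (Set (Fin n → ℝ)) :=
  {C | ∃ x ∈ (⋃ k, H k)ᶜ, C = connectedComponentIn (⋃ k, H k)ᶜ x}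

/-- The number of regions defined by a family of `m` affine hyperplanes in `ℝ^n`
is finite and at most `∑_{i=0}^n binomial(m, i)`. -/
theorem regions_finite_and_card_le (n m : ℕ) (H : Fin m → Set (Fin n → ℝ))
    (hH : ∀ k, IsAffineHyperplane (H k)) :
    (regions H).Finite ∧
      (regions H).ncard ≤ ∑ i ∈ Finset.range (n + 1), Nat.choose m i := by
  choose f c _ hfc using hH
  have hcompl : (⋃ k, H k)ᶜ = {x | ∀ k, f k x ≠ c k} := by
    ext x
    simp [hfc]
  have hsub : regions H ⊆ (fun A : Finset (Fin m) =>
      {y | ∃ x, (∀ k, f k x ≠ c k) ∧ positiveIndices f c x = A ∧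
        y ∈ connectedComponentIn (⋃ k, H k)ᶜ x}) '' (signFamily f c : Set (Finset (Fin m))) := by
    rintro _ ⟨x, hx, rfl⟩
    rw [hcompl] at hx ⊢
    refine ⟨positiveIndices f c x, mem_signFamily.2 ⟨x, hx, rfl⟩, Set.Subset.antisymm ?_ ?_⟩
    · rintro y ⟨z, hz, hzx, hy⟩
      have hmem : x ∈ connectedComponentIn {x | ∀ k, f k x ≠ c k} z :=
        (convex_segment z x).isPreconnected.subset_connectedComponentIn (left_mem_segment ℝ z x)
          (segment_subset_of_positiveIndices_eq hz hx hzx) (right_mem_segment ℝ z x)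
      rwa [connectedComponentIn_eq hmem] at hy
    · exact fun y hy => ⟨x, hx, rfl, hy⟩
  have hfin := (signFamily f c).finite_toSet
  refine ⟨(hfin.image _).subset hsub, ?_⟩
  calc (regions H).ncard ≤ _ := Set.ncard_le_ncard hsub (hfin.image _)
    _ ≤ (signFamily f c : Set (Finset (Fin m))).ncard := Set.ncard_image_le hfin
    _ = (signFamily f c).card := Set.ncard_coe_finset _
    _ ≤ _ := by simpa using card_signFamily_le f c
end

section
/- Let n and m be natural numbers and let H_1, …, H_m be affine hyperplanes in ℝ^n. Then the total number of extended regions of the family, i.e., the sum over all subsets I ⊆ {1, …, m} of the number of connected components of (⋂_{k ∈ I} H_k) \ (⋃_{k ∉ I} H_k), is finite and at most ∑_{p=0}^{n} binomial(m, p) · ∑_{i=0}^{n-p} binomial(m−p, i). -/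
/-- The set on whose connected components the extended regions associated with
a subset `I` of the hyperplanes are defined:
`(⋂ k ∈ I, H k) \ (⋃ k ∉ I, H k)`. -/
def extendedRegionBase {n m : ℕ} (H : Fin m → Set (Fin n → ℝ)) (I : Finset (Fin m)) :
    Set (Fin n → ℝ) :=
  (⋂ k ∈ I, H k) \ (⋃ k ∈ Iᶜ, H k)

/-- The set of extended regions associated with a subset `I`: the connected
components of `(⋂ k ∈ I, H k) \ (⋃ k ∉ I, H k)`. -/
def extendedRegions {n m : ℕ} (H : Fin m → Set (Fin n → ℝ)) (I : Finset (Fin m)) :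
    Set (Set (Fin n → ℝ)) :=
  {C | ∃ x ∈ extendedRegionBase H I, C = connectedComponentIn (extendedRegionBase H I) x}

/-- The vector of signs at `x` of a finite family of affine functions. -/
noncomputable def signVector {E : Type*} [AddCommGroup E] [Module ℝ E] {m : ℕ}
    (g : Fin m → E →ᵃ[ℝ] ℝ) (x : E) : Fin m → SignType :=
  fun i => SignType.sign (g i x)

theorem convex_sign_eq (s : SignType) : Convex ℝ {r : ℝ | SignType.sign r = s} := by
  cases s
  · simp only [SignType.zero_eq_zero, sign_eq_zero_iff]
    exact convex_singleton 0
  · simp only [SignType.neg_eq_neg_one, sign_eq_neg_one_iff]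
    exact convex_Iio 0
  · simp only [SignType.pos_eq_one, sign_eq_one_iff]
    exact convex_Ioi 0

theorem convex_signVector_eq {E : Type*} [AddCommGroup E] [Module ℝ E] {m : ℕ}
    (g : Fin m → E →ᵃ[ℝ] ℝ) (σ : Fin m → SignType) : Convex ℝ {x | signVector g x = σ} := by
  have h : {x | signVector g x = σ} = ⋂ i, g i ⁻¹' {r : ℝ | SignType.sign r = σ i} := by
    ext x
    simp [signVector, funext_iff]
  rw [h]
  exact convex_iInter fun i => (convex_sign_eq (σ i)).affine_preimage (g i)

/-- An affine function taking both signs on a convex set vanishes somewhere on it. -/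
theorem Convex.exists_affineMap_eq_zero {E : Type*} [AddCommGroup E] [Module ℝ E] {s : Set E}
    (hs : Convex ℝ s) (g : E →ᵃ[ℝ] ℝ) {x y : E} (hx : x ∈ s) (hy : y ∈ s)
    (hgx : 0 < g x) (hgy : g y < 0) : ∃ z ∈ s, g z = 0 := by
  have h : Convex ℝ (g '' s) := hs.affine_image g
  exact h.ordConnected.out ⟨y, hy, rfl⟩ ⟨x, hx, rfl⟩ ⟨hgy.le, hgx.le⟩

theorem sum_choose_mul_two_pow_succ (d m : ℕ) :
    ∑ j ∈ Finset.range (d + 2), (m + 1).choose j * 2 ^ j =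
      ∑ j ∈ Finset.range (d + 2), m.choose j * 2 ^ j +
        2 * ∑ j ∈ Finset.range (d + 1), m.choose j * 2 ^ j := by
  rw [Finset.sum_range_succ' _ (d + 1), Finset.sum_range_succ' _ (d + 1), Finset.mul_sum]
  simp only [Nat.choose_succ_succ', Nat.choose_zero_right, pow_zero, mul_one]
  rw [add_right_comm, ← Finset.sum_add_distrib]
  congr 1
  exact Finset.sum_congr rfl fun j _ => by ring

theorem sum_choose_mul_sum_choose (n m : ℕ) :
    ∑ p ∈ Finset.range (n + 1), m.choose p * ∑ i ∈ Finset.range (n - p + 1), (m - p).choose i =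
      ∑ j ∈ Finset.range (n + 1), m.choose j * 2 ^ j := by
  simp_rw [← Nat.sum_range_choose, Finset.mul_sum]
  rw [Finset.sum_sigma', Finset.sum_sigma']
  refine Finset.sum_bij' (fun a _ => ⟨a.1 + a.2, a.1⟩) (fun b _ => ⟨b.2, b.1 - b.2⟩) ?_ ?_ ?_ ?_ ?_
  · rintro ⟨p, i⟩ h
    simp only [Finset.mem_sigma, Finset.mem_range] at h ⊢
    omega
  · rintro ⟨j, p⟩ h
    simp only [Finset.mem_sigma, Finset.mem_range] at h ⊢
    omega
  · rintro ⟨p, i⟩ _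
    simp
  · rintro ⟨j, p⟩ h
    simp only [Finset.mem_sigma, Finset.mem_range] at h
    have : p + (j - p) = j := by omega
    simp [this]
  · rintro ⟨p, i⟩ _
    simpa using (Nat.choose_mul (n := m) (Nat.le_add_right p i)).symm

/-- A set of sign vectors is counted by its tails, where a tail extended by both nonzero signs
is assumed to be also extended by zero. -/
theorem ncard_le_ncard_tail_add {m : ℕ} (T : Set (Fin (m + 1) → SignType))
    (h : ∀ σ : Fin m → SignType, (Fin.cons 1 σ : Fin (m + 1) → SignType) ∈ T →
      (Fin.cons (-1) σ : Fin (m + 1) → SignType) ∈ T →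
      (Fin.cons 0 σ : Fin (m + 1) → SignType) ∈ T) :
    T.ncard ≤ (Fin.tail '' T).ncard +
      2 * {σ : Fin m → SignType | (Fin.cons 0 σ : Fin (m + 1) → SignType) ∈ T}.ncard := by
  let A (s : SignType) : Set (Fin m → SignType) :=
    {σ | (Fin.cons s σ : Fin (m + 1) → SignType) ∈ T}
  have hT : T ⊆ (Fin.cons 0 '' A 0) ∪ ((Fin.cons 1 '' A 1) ∪ (Fin.cons (-1) '' A (-1))) := by
    intro τ hτ
    have hcons : (Fin.cons (τ 0) (Fin.tail τ) : Fin (m + 1) → SignType) = τ :=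
      Fin.cons_self_tail τ
    have hA : Fin.tail τ ∈ A (τ 0) := by
      change Fin.cons (τ 0) (Fin.tail τ) ∈ T
      rwa [hcons]
    have hs : τ 0 = 0 ∨ τ 0 = 1 ∨ τ 0 = -1 := by
      generalize τ 0 = s
      revert s
      decide
    rcases hs with hs | hs | hs <;> rw [hs] at hA hcons
    · exact Or.inl ⟨_, hA, hcons⟩
    · exact Or.inr (Or.inl ⟨_, hA, hcons⟩)
    · exact Or.inr (Or.inr ⟨_, hA, hcons⟩)
  have hcard (s : SignType) :
      ((Fin.cons s '' A s : Set (Fin (m + 1) → SignType))).ncard ≤ (A s).ncard :=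
    Set.ncard_image_le (Set.toFinite _)
  have hunion : (A 1 ∪ A (-1)).ncard ≤ (Fin.tail '' T).ncard := by
    refine Set.ncard_le_ncard ?_ (Set.toFinite _)
    rintro σ (hσ | hσ)
    · exact ⟨_, hσ, Fin.tail_cons _ _⟩
    · exact ⟨_, hσ, Fin.tail_cons _ _⟩
  have hinter : (A 1 ∩ A (-1)).ncard ≤ (A 0).ncard :=
    Set.ncard_le_ncard (fun σ hσ => h σ hσ.1 hσ.2) (Set.toFinite _)
  have hadd := Set.ncard_union_add_ncard_inter (A 1) (A (-1)) (Set.toFinite _) (Set.toFinite _)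
  have h1 := Set.ncard_le_ncard hT (Set.toFinite _)
  have h2 := Set.ncard_union_le (Fin.cons 0 '' A 0 : Set (Fin (m + 1) → SignType))
    ((Fin.cons 1 '' A 1) ∪ (Fin.cons (-1) '' A (-1)))
  have h3 := Set.ncard_union_le (Fin.cons 1 '' A 1 : Set (Fin (m + 1) → SignType))
    (Fin.cons (-1) '' A (-1))
  have := hcard 0
  have := hcard 1
  have := hcard (-1)
  change _ ≤ _ + 2 * (A 0).ncard
  omega

/-- On an affine subspace of dimension at most `d`, a family of `m` affine functions (which may be
constant) takes at most `∑ j ≤ d, m.choose j * 2 ^ j` sign vectors. -/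
theorem ncard_signVector_image_le {E : Type*} [AddCommGroup E] [Module ℝ E]
    [FiniteDimensional ℝ E] {m : ℕ} (g : Fin m → E →ᵃ[ℝ] ℝ) (d : ℕ) (W : Submodule ℝ E)
    (hW : Module.finrank ℝ W ≤ d) (x₀ : E) :
    (signVector g '' {x | x - x₀ ∈ W}).ncard ≤
      ∑ j ∈ Finset.range (d + 1), m.choose j * 2 ^ j := by
  induction m generalizing d W x₀ with
  | zero =>
    refine (Set.ncard_le_one_of_subsingleton _).trans ?_
    rw [Finset.sum_range_succ']
    simp
  | succ m ih =>
    have htail : Fin.tail '' (signVector g '' {x | x - x₀ ∈ W}) =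
        signVector (Fin.tail g) '' {x | x - x₀ ∈ W} := by
      rw [Set.image_image]
      rfl
    by_cases hconst : ∀ w ∈ W, (g 0).linear w = 0
    · have hg (x : E) (hx : x - x₀ ∈ W) : g 0 x = g 0 x₀ := by
        have := (g 0).linearMap_vsub x x₀
        rw [vsub_eq_sub, hconst _ hx, vsub_eq_sub] at this
        linarith
      have hinj : Set.InjOn Fin.tail (signVector g '' {x | x - x₀ ∈ W}) := by
        rintro _ ⟨x, hx, rfl⟩ _ ⟨y, hy, rfl⟩ hxy
        rw [← Fin.cons_self_tail (signVector g x), ← Fin.cons_self_tail (signVector g y), hxy]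
        simp [signVector, hg x hx, hg y hy]
      rw [← hinj.ncard_image, htail]
      refine (ih (Fin.tail g) d W hW x₀).trans (Finset.sum_le_sum fun j _ => ?_)
      gcongr
      omega
    · push Not at hconst
      obtain ⟨w, hwW, hw⟩ := hconst
      let W' : Submodule ℝ E := W ⊓ LinearMap.ker (g 0).linear
      have hlt : W' < W := by
        refine lt_of_le_of_ne inf_le_left fun h => hw ?_
        have : w ∈ W' := h ▸ hwW
        exact this.2
      have hrank := Submodule.finrank_lt_finrank_of_lt hlt
      obtain ⟨e, rfl⟩ : ∃ e, d = e + 1 := ⟨d - 1, by omega⟩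
      let x₁ : E := x₀ + (-(g 0 x₀) / (g 0).linear w) • w
      have hx₁ : g 0 x₁ = 0 := by
        have := (g 0).map_vadd x₀ ((-(g 0 x₀) / (g 0).linear w) • w)
        rw [vadd_eq_add, add_comm _ x₀] at this
        refine this.trans ?_
        rw [map_smul, smul_eq_mul, vadd_eq_add, div_mul_cancel₀ _ hw]
        ring
      have hx₁W : x₁ - x₀ ∈ W := by
        simpa [x₁] using W.smul_mem _ hwW
      have hzero (x : E) (hx : x - x₀ ∈ W) (hgx : g 0 x = 0) : x - x₁ ∈ W' := by
        refine ⟨by simpa using W.sub_mem hx hx₁W, ?_⟩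
        have := (g 0).linearMap_vsub x x₁
        rw [hgx, hx₁] at this
        simpa using this
      have hconvex : Convex ℝ {x | x - x₀ ∈ W} :=
        W.convex.affine_preimage (AffineMap.id ℝ E - AffineMap.const ℝ E x₀)
      have hle := ncard_le_ncard_tail_add (signVector g '' {x | x - x₀ ∈ W}) <| by
        rintro σ ⟨x, hx, hxσ⟩ ⟨y, hy, hyσ⟩
        have hx0 : 0 < g 0 x := by
          simpa [signVector, sign_eq_one_iff] using congrFun hxσ 0
        have hy0 : g 0 y < 0 := by
          simpa [signVector, sign_eq_neg_one_iff] using congrFun hyσ 0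
        have hxt : signVector (Fin.tail g) x = σ := congrArg Fin.tail hxσ
        have hyt : signVector (Fin.tail g) y = σ := congrArg Fin.tail hyσ
        obtain ⟨z, ⟨hz, hzt⟩, hz0⟩ :=
          (hconvex.inter (convex_signVector_eq (Fin.tail g) σ)).exists_affineMap_eq_zero (g 0)
            ⟨hx, hxt⟩ ⟨hy, hyt⟩ hx0 hy0
        refine ⟨z, hz, ?_⟩
        rw [← Fin.cons_self_tail (signVector g z)]
        congr 1
        simp [signVector, hz0]
      have hsub : {σ : Fin m → SignType | (Fin.cons 0 σ : Fin (m + 1) → SignType) ∈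
          signVector g '' {x | x - x₀ ∈ W}} ⊆
          signVector (Fin.tail g) '' {x | x - x₁ ∈ W'} := by
        rintro σ ⟨x, hx, hxσ⟩
        refine ⟨x, hzero x hx ?_, congrArg Fin.tail hxσ⟩
        simpa [signVector] using congrFun hxσ 0
      have h1 := ih (Fin.tail g) (e + 1) W hW x₀
      have h2 := ih (Fin.tail g) e W' (by omega) x₁
      have h3 := Set.ncard_le_ncard hsub (Set.toFinite _)
      rw [htail] at hle
      rw [show e + 1 + 1 = e + 2 from rfl] at h1 ⊢
      rw [sum_choose_mul_two_pow_succ]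
      omega

/-- A subset `I` has at most as many extended regions as there are sign vectors vanishing
exactly on `I`. -/
theorem extendedRegions_finite_and_ncard_le {n m : ℕ} (H : Fin m → Set (Fin n → ℝ))
    (g : Fin m → (Fin n → ℝ) →ᵃ[ℝ] ℝ) (hg : ∀ k x, x ∈ H k ↔ g k x = 0) (I : Finset (Fin m)) :
    (extendedRegions H I).Finite ∧ (extendedRegions H I).ncard ≤
      {σ ∈ Set.range (signVector g) | Finset.univ.filter (fun k => σ k = 0) = I}.ncard := by
  have hbase (x : Fin n → ℝ) : x ∈ extendedRegionBase H I ↔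
      Finset.univ.filter (fun k => signVector g x k = 0) = I := by
    simp only [extendedRegionBase, Set.mem_sdiff, Set.mem_iInter, Set.mem_iUnion,
      Finset.mem_compl, hg, signVector, sign_eq_zero_iff, Finset.ext_iff, Finset.mem_filter,
      Finset.mem_univ, true_and]
    grind
  have hsub : extendedRegions H I ⊆
      (fun σ => connectedComponentIn (extendedRegionBase H I)
        (Function.invFun (signVector g) σ)) ''
        {σ ∈ Set.range (signVector g) | Finset.univ.filter (fun k => σ k = 0) = I} := by
    rintro _ ⟨x, hx, rfl⟩
    refine ⟨signVector g x, ⟨⟨x, rfl⟩, (hbase x).1 hx⟩, ?_⟩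
    have hy : signVector g (Function.invFun (signVector g) (signVector g x)) = signVector g x :=
      Function.invFun_eq ⟨x, rfl⟩
    refine (connectedComponentIn_eq ?_).symm
    refine (convex_signVector_eq g (signVector g x)).isPreconnected.subset_connectedComponentIn
      rfl ?_ hy
    intro z hz
    rw [hbase, show signVector g z = signVector g x from hz, ← hbase]
    exact hx
  exact ⟨(Set.toFinite _).subset hsub,
    (Set.ncard_le_ncard hsub (Set.toFinite _)).trans (Set.ncard_image_le (Set.toFinite _))⟩

/-- The total number of extended regions defined by a family of `m` affine
hyperplanes in `ℝ^n` — summed over all subsets `I ⊆ {1,…,m}` — is finite and at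
most `∑_{p=0}^n binomial(m,p) · ∑_{i=0}^{n-p} binomial(m-p, i)`. -/
theorem extendedRegions_finite_and_card_le (n m : ℕ) (H : Fin m → Set (Fin n → ℝ))
    (hH : ∀ k, IsAffineHyperplane (H k)) :
    (∀ I : Finset (Fin m), (extendedRegions H I).Finite) ∧
      (∑ I : Finset (Fin m), (extendedRegions H I).ncard) ≤
        ∑ p ∈ Finset.range (n + 1),
          Nat.choose m p * ∑ i ∈ Finset.range (n - p + 1), Nat.choose (m - p) i := by
  choose f c _ hfc using hH
  let g (k : Fin m) : (Fin n → ℝ) →ᵃ[ℝ] ℝ := (f k).toAffineMap - AffineMap.const ℝ _ (c k)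
  have hg (k : Fin m) (x : Fin n → ℝ) : x ∈ H k ↔ g k x = 0 := by
    simp [hfc k, g, sub_eq_zero]
  refine ⟨fun I => (extendedRegions_finite_and_ncard_le H g hg I).1, ?_⟩
  rw [sum_choose_mul_sum_choose]
  have hrange : Set.range (signVector g) =
      signVector g '' {x | x - 0 ∈ (⊤ : Submodule ℝ (Fin n → ℝ))} := by
    simp
  refine le_trans ?_ (hrange ▸ ncard_signVector_image_le g n ⊤ (by simp) 0)
  classical
  calc ∑ I : Finset (Fin m), (extendedRegions H I).ncard
      ≤ ∑ I : Finset (Fin m),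
          {σ ∈ Set.range (signVector g) | Finset.univ.filter (fun k => σ k = 0) = I}.ncard :=
        Finset.sum_le_sum fun I _ => (extendedRegions_finite_and_ncard_le H g hg I).2
    _ = ∑ I : Finset (Fin m), ((Set.range (signVector g)).toFinset.filter
          (fun σ => Finset.univ.filter (fun k => σ k = 0) = I)).card := by
        refine Finset.sum_congr rfl fun I _ => ?_
        rw [← Set.ncard_coe_finset]
        simp
    _ = (Set.range (signVector g)).ncard := by
        rw [← Finset.card_eq_sum_card_fiberwise fun σ _ => Finset.mem_coe.2 (Finset.mem_univ _),
          Set.ncard_eq_toFinset_card']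
end

section
/- For all natural numbers n and m with m ≥ 1, the inequality ∑_{p=0}^{n} binomial(m, p) · ∑_{i=0}^{n-p} binomial(m−p, i) ≤ e² · m^n holds, where the left-hand side is interpreted as a real number and e = exp(1). -/
open Real

/-- If `a ≤ m`, `1 ≤ m`, then `∑_{i=0}^k binomial(a,i) ≤ e · m^k`. -/
lemma sum_choose_le_exp_mul_pow {a m : ℕ} (ha : a ≤ m) (hm : 1 ≤ m) (k : ℕ) :
    ∑ i ∈ Finset.range (k + 1), (Nat.choose a i : ℝ) ≤ Real.exp 1 * (m : ℝ) ^ k := by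
  have hm' : (1 : ℝ) ≤ m := by exact_mod_cast hm
  have ha' : (a : ℝ) ≤ m := by exact_mod_cast ha
  calc ∑ i ∈ Finset.range (k + 1), (Nat.choose a i : ℝ)
      ≤ ∑ i ∈ Finset.range (k + 1), (1 : ℝ) ^ i / (i.factorial : ℝ) * (m : ℝ) ^ k := by
        refine Finset.sum_le_sum fun i hi => ?_
        have hik : i ≤ k := Nat.lt_succ_iff.mp (Finset.mem_range.mp hi)
        calc (Nat.choose a i : ℝ) ≤ (a : ℝ) ^ i / (i.factorial : ℝ) := Nat.choose_le_pow_div i a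
          _ ≤ (m : ℝ) ^ k / (i.factorial : ℝ) := by
            gcongr
            exact (pow_le_pow_left₀ a.cast_nonneg ha' i).trans (pow_le_pow_right₀ hm' hik)
          _ = (1 : ℝ) ^ i / (i.factorial : ℝ) * (m : ℝ) ^ k := by rw [one_pow]; ring
    _ ≤ Real.exp 1 * (m : ℝ) ^ k := by
        rw [← Finset.sum_mul]
        gcongr
        exact Real.sum_le_exp_of_nonneg zero_le_one _

/-- For `m ≥ 1`, `∑_{p=0}^n binomial(m,p) · ∑_{i=0}^{n-p} binomial(m-p,i) ≤ e² · m^n`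
as real numbers. -/
theorem sum_binomial_le_exp_sq_mul_pow (n m : ℕ) (hm : 1 ≤ m) :
    (∑ p ∈ Finset.range (n + 1),
        (Nat.choose m p : ℝ) * ∑ i ∈ Finset.range (n - p + 1), (Nat.choose (m - p) i : ℝ)) ≤
      Real.exp 1 ^ 2 * (m : ℝ) ^ n := by
  calc _ ≤ ∑ p ∈ Finset.range (n + 1),
        (1 : ℝ) ^ p / (p.factorial : ℝ) * (Real.exp 1 * (m : ℝ) ^ n) := by
        refine Finset.sum_le_sum fun p hp => ?_
        have hpn : p ≤ n := Nat.lt_succ_iff.mp (Finset.mem_range.mp hp)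
        calc _ ≤ (m : ℝ) ^ p / (p.factorial : ℝ) * (Real.exp 1 * (m : ℝ) ^ (n - p)) := by
              gcongr
              · exact Nat.choose_le_pow_div p m
              · exact sum_choose_le_exp_mul_pow (Nat.sub_le m p) hm (n - p)
          _ = (1 : ℝ) ^ p / (p.factorial : ℝ) * (Real.exp 1 * (m : ℝ) ^ n) := by
              rw [← pow_mul_pow_sub (m : ℝ) hpn, one_pow]
              ring
    _ ≤ Real.exp 1 * (Real.exp 1 * (m : ℝ) ^ n) := by
        rw [← Finset.sum_mul]
        gcongr
        exact Real.sum_le_exp_of_nonneg zero_le_one _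
    _ = Real.exp 1 ^ 2 * (m : ℝ) ^ n := by ring
end

section
/- Let T be a finite set of cardinality E (the 'transitions'), equipped with three functions: a level lvl : T → {1, …, n}, a Boolean upd : T → Bool (indicating whether a transition updates the clock of its own level), and a policy pol : T → {Lazy, Urgent, Delayed}. Then every finite sequence e_1, …, e_l of elements of T of length l > (E + n)^{3n} contains two indices i < j with e_i = e_j such that, writing p = lvl(e_i), every k with i ≤ k ≤ j satisfies lvl(e_k) ≥ p, and moreover one of the following three cases holds: (a) upd(e_i) = true; (b) no k with i ≤ k ≤ j satisfies (lvl(e_k) = p and upd(e_k) = true), and pol(e_i) ∈ {Lazy, Delayed}; (c) no k with i ≤ k ≤ j satisfies (lvl(e_k) = p and upd(e_k) = true), and every k with i ≤ k ≤ j with lvl(e_k) = p satisfies pol(e_k) = Urgent. -/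
/-- Timing policies of states/transitions of an interrupt timed automaton. -/
inductive Policy : Type
  | Lazy : Policy
  | Urgent : Policy
  | Delayed : Policy

/-- A sequence whose ranks take at most `q` values, over an alphabet of `E` letters, has within any
window of length `(E + 1) ^ q` two occurrences of a letter with no smaller rank in between. -/
theorem exists_repeat_of_rank_min {T : Type*} [Fintype T] (r : T → ℕ) (f : ℕ → T) (q : ℕ) :
    ∀ m a : ℕ,
      (∀ k, a ≤ k → k < a + (Fintype.card T + 1) ^ q → m ≤ r (f k) ∧ r (f k) < m + q) →
      ∃ i j, a ≤ i ∧ i < j ∧ j < a + (Fintype.card T + 1) ^ q ∧ f i = f j ∧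
        ∀ k, i ≤ k → k ≤ j → r (f i) ≤ r (f k) := by
  induction q with
  | zero =>
    intro m a h
    have := h a le_rfl (by simp)
    omega
  | succ q ih =>
    intro m a h
    set B := (Fintype.card T + 1) ^ q with hB
    have hpow : (Fintype.card T + 1) ^ (q + 1) = (Fintype.card T + 1) * B := by
      rw [pow_succ, mul_comm]
    rw [hpow] at h ⊢
    have hblock : ∀ b : Fin (Fintype.card T + 1),
        b.val * B + B ≤ (Fintype.card T + 1) * B := fun b => by
      rw [← Nat.succ_mul]
      exact Nat.mul_le_mul_right B b.isLt
    by_cases hmin : ∀ b : Fin (Fintype.card T + 1),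
        ∃ k, a + b.val * B ≤ k ∧ k < a + b.val * B + B ∧ r (f k) = m
    · choose g hg_lb hg_ub hg_rank using hmin
      obtain ⟨b, c, hbc, hgbc⟩ := Fintype.exists_ne_map_eq_of_card_lt (fun b => f (g b)) (by simp)
      wlog hlt : b < c generalizing b c
      · exact this c b hbc.symm hgbc.symm (lt_of_le_of_ne (not_lt.mp hlt) hbc.symm)
      have hmul : b.val * B + B ≤ c.val * B := by
        rw [← Nat.succ_mul]
        exact Nat.mul_le_mul_right B hlt
      have := hg_lb b
      have := hg_ub b
      have := hg_lb c
      have := hg_ub c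
      have := hblock c
      refine ⟨g b, g c, by omega, by omega, by omega, hgbc, fun k hk hk' => ?_⟩
      rw [hg_rank]
      exact (h k (by omega) (by omega)).1
    · push Not at hmin
      obtain ⟨b, hb⟩ := hmin
      have hb' := hblock b
      obtain ⟨i, j, hi, hij, hj, heq, hrank⟩ := ih (m + 1) (a + b.val * B) fun k hk hk' => by
        have := hb k hk hk'
        have := h k (by omega) (by omega)
        omega
      exact ⟨i, j, by omega, hij, by omega, heq, hrank⟩

/-- Within a level, updating transitions come first, then lazy or delayed ones, then urgent ones. -/
def subrank (u : Bool) (p : Policy) : ℕ :=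
  match u, p with
  | true, _ => 0
  | false, .Lazy => 1
  | false, .Delayed => 1
  | false, .Urgent => 2

theorem subrank_le_two (u : Bool) (p : Policy) : subrank u p ≤ 2 := by
  cases u <;> cases p <;> simp [subrank]

theorem subrank_eq_zero {u : Bool} {p : Policy} : subrank u p = 0 ↔ u = true := by
  cases u <;> cases p <;> simp [subrank]

theorem subrank_eq_one {u : Bool} {p : Policy} (h : subrank u p = 1) :
    p = Policy.Lazy ∨ p = Policy.Delayed := by
  cases u <;> cases p <;> simp_all [subrank]

theorem subrank_eq_two {u : Bool} {p : Policy} (h : subrank u p = 2) : p = Policy.Urgent := by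
  cases u <;> cases p <;> simp_all [subrank]

/-- Counting Lemma for ITA₋. Let `T` be a finite set of `E` transitions with a
level in `{1,…,n}`, a Boolean flag telling whether the transition updates the
clock of its own level, and a timing policy. Then every sequence of transitions
of length `l > (E+n)^{3n}` contains two positions `i < j` carrying the same
transition such that all intermediate transitions have level at least the level
`p` of `e i`, and moreover: (a) `e i` updates `x_p`; or (b) no intermediate
transition of level `p` updates `x_p` and `e i` is lazy or delayed; or (c) no
intermediate transition of level `p` updates `x_p` and all intermediate
transitions of level `p` are urgent. -/
theorem counting_lemma {T : Type*} [Fintype T] (E n l : ℕ) (hE : Fintype.card T = E)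
    (lvl : T → ℕ) (hlvl : ∀ t, 1 ≤ lvl t ∧ lvl t ≤ n)
    (upd : T → Bool) (pol : T → Policy)
    (hl : (E + n) ^ (3 * n) < l) (e : Fin l → T) :
    ∃ i j : Fin l, i < j ∧ e i = e j ∧
      (∀ k, i ≤ k → k ≤ j → lvl (e i) ≤ lvl (e k)) ∧
      (upd (e i) = true ∨
        ((∀ k, i ≤ k → k ≤ j → ¬(lvl (e k) = lvl (e i) ∧ upd (e k) = true)) ∧
          (pol (e i) = Policy.Lazy ∨ pol (e i) = Policy.Delayed)) ∨
        ((∀ k, i ≤ k → k ≤ j → ¬(lvl (e k) = lvl (e i) ∧ upd (e k) = true)) ∧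
          (∀ k, i ≤ k → k ≤ j → lvl (e k) = lvl (e i) → pol (e k) = Policy.Urgent))) := by
  have hl_pos : 0 < l := by omega
  have hn : 1 ≤ n := (hlvl (e ⟨0, hl_pos⟩)).1.trans (hlvl (e ⟨0, hl_pos⟩)).2
  let c : T → ℕ := fun t => subrank (upd t) (pol t)
  have hc_le : ∀ t, c t ≤ 2 := fun t => subrank_le_two _ _
  let f : ℕ → T := fun k => e ⟨min k (l - 1), by omega⟩
  have hf : ∀ k : Fin l, f k = e k := fun k =>
    congrArg e (Fin.ext (min_eq_left (by omega)))
  obtain ⟨i, j, -, hij, hj, heq, hrank⟩ :=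
    exists_repeat_of_rank_min (fun t => 3 * lvl t + c t) f (3 * n) 3 0 fun k _ _ => by
      have := hlvl (f k)
      have := hc_le (f k)
      omega
  have hpow : (Fintype.card T + 1) ^ (3 * n) ≤ (E + n) ^ (3 * n) :=
    Nat.pow_le_pow_left (by omega) _
  lift i to Fin l using by omega
  lift j to Fin l using by omega
  rw [hf, hf] at heq
  have hmin : ∀ k, i ≤ k → k ≤ j → 3 * lvl (e i) + c (e i) ≤ 3 * lvl (e k) + c (e k) :=
    fun k hk hk' => by simpa only [hf] using hrank k hk hk'
  refine ⟨i, j, hij, heq, fun k hk hk' => ?_, ?_⟩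
  · have := hmin k hk hk'
    have := hc_le (e k)
    omega
  have hc : ∀ k, i ≤ k → k ≤ j → lvl (e k) = lvl (e i) → c (e i) ≤ c (e k) :=
    fun k hk hk' hlev => by
      have := hmin k hk hk'
      omega
  by_cases h0 : c (e i) = 0
  · exact Or.inl (subrank_eq_zero.mp h0)
  have hno_upd : ∀ k, i ≤ k → k ≤ j → ¬(lvl (e k) = lvl (e i) ∧ upd (e k) = true) :=
    fun k hk hk' ⟨hlev, hu⟩ => by
      have := hc k hk hk' hlev
      have : c (e k) = 0 := subrank_eq_zero.mpr hu
      omega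
  by_cases h1 : c (e i) = 1
  · exact Or.inr (Or.inl ⟨hno_upd, subrank_eq_one h1⟩)
  · refine Or.inr (Or.inr ⟨hno_upd, fun k hk hk' hlev => subrank_eq_two (u := upd (e k)) ?_⟩)
    have := hc k hk hk' hlev
    have := hc_le (e i)
    have := hc_le (e k)
    change c (e k) = 2
    omega
end
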